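/- arXiv:math-ph/9911031 — 4 statements merged into one kernel-verified Lean document; each statement's English description precedes it below -/
import Mathlib

section
/- Let H : ℝ → ℝ be continuous and even, and let x > 0. Assume that the only continuous function ψ on [0,x] satisfying ψ(t) + ∫₀ˣ H(t−u) ψ(u) du = 0 for all t ∈ [0,x] is ψ ≡ 0. If Γ : [0,x] × [0,x] → ℝ is continuous and satisfies Γ(t,s) + ∫₀ˣ H(t−u) Γ(u,s) du = H(t−s) for all t, s ∈ [0,x], then Γ(t,s) = Γ(x−t, x−s) for all t, s ∈ [0,x]. -/
open MeasureTheory Set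

/-- **Symmetry of the Krein kernel (formula (2.21)):** `Γₓ(t,s) = Γₓ(x-t,x-s)`.
Let `H : ℝ → ℝ` be continuous and even, `x > 0`, and suppose the homogeneous
equation `ψ(t) + ∫₀ˣ H(t-u) ψ(u) du = 0` has only the trivial continuous
solution on `[0,x]`. If `Γ : [0,x]×[0,x] → ℝ` is continuous and satisfies
`Γ(t,s) + ∫₀ˣ H(t-u) Γ(u,s) du = H(t-s)` for all `t,s ∈ [0,x]`, then
`Γ(t,s) = Γ(x-t, x-s)` for all `t,s ∈ [0,x]`. -/
theorem krein_kernel_symmetry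
    (H : ℝ → ℝ) (hHc : Continuous H) (heven : ∀ t : ℝ, H (-t) = H t)
    (x : ℝ) (hx : 0 < x)
    (huniq : ∀ ψ : ℝ → ℝ, ContinuousOn ψ (Icc 0 x) →
      (∀ t ∈ Icc (0:ℝ) x, ψ t + ∫ u in (0:ℝ)..x, H (t - u) * ψ u = 0) →
      ∀ t ∈ Icc (0:ℝ) x, ψ t = 0)
    (Γ : ℝ → ℝ → ℝ)
    (hΓc : ContinuousOn (fun p : ℝ × ℝ => Γ p.1 p.2) (Icc 0 x ×ˢ Icc 0 x))
    (hΓeq : ∀ t ∈ Icc (0:ℝ) x, ∀ s ∈ Icc (0:ℝ) x,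
      Γ t s + ∫ u in (0:ℝ)..x, H (t - u) * Γ u s = H (t - s)) :
    ∀ t ∈ Icc (0:ℝ) x, ∀ s ∈ Icc (0:ℝ) x, Γ t s = Γ (x - t) (x - s) := by
  intro t ht s hs
  have hmem : ∀ v ∈ Icc (0:ℝ) x, x - v ∈ Icc (0:ℝ) x := fun v hv =>
    ⟨by linarith [hv.2], by linarith [hv.1]⟩
  have hc : ∀ v ∈ Icc (0:ℝ) x, ContinuousOn (fun u => Γ u v) (Icc 0 x) := by
    intro v hv
    exact hΓc.comp (f := fun u : ℝ => (u, v)) (by fun_prop) (fun u hu => ⟨hu, hv⟩)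
  have hc1 := hc s hs
  have hc2 : ContinuousOn (fun u => Γ (x - u) (x - s)) (Icc 0 x) :=
    (hc (x - s) (hmem s hs)).comp (f := fun u : ℝ => x - u) (by fun_prop) hmem
  have key := huniq (fun u => Γ u s - Γ (x - u) (x - s)) (hc1.sub hc2) ?_ t ht
  · exact sub_eq_zero.mp key
  intro r hr
  have hH : ContinuousOn (fun u => H (r - u)) (Icc 0 x) := by fun_prop
  have i1 : IntervalIntegrable (fun u => H (r - u) * Γ u s) volume 0 x :=
    (hH.mul hc1).intervalIntegrable_of_Icc hx.le
  have i2 : IntervalIntegrable (fun u => H (r - u) * Γ (x - u) (x - s)) volume 0 x :=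
    (hH.mul hc2).intervalIntegrable_of_Icc hx.le
  have e1 := hΓeq r hr s hs
  have e2 := hΓeq (x - r) (hmem r hr) (x - s) (hmem s hs)
  have e3 : (∫ u in (0:ℝ)..x, H (r - u) * Γ (x - u) (x - s))
      = ∫ u in (0:ℝ)..x, H (x - r - u) * Γ u (x - s) := by
    have h := intervalIntegral.integral_comp_sub_left (a := 0) (b := x)
      (fun u => H (x - r - u) * Γ u (x - s)) x
    rw [sub_self, sub_zero] at h
    rw [← h]
    congr 1
    ext u
    rw [← heven (r - u)]
    congr 2
    ring
  have e4 : H (x - r - (x - s)) = H (r - s) := by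
    rw [← heven (r - s)]
    congr 1
    ring
  simp only [mul_sub]
  rw [intervalIntegral.integral_sub i1 i2, e3]
  linarith
end

section
/- Let H : ℝ → ℝ be continuous and even, let I ⊆ (0,∞) be an open interval, and let Γ : I × ℝ × ℝ → ℝ, written (x,t,s) ↦ Γ_x(t,s), be continuous and continuously differentiable in x. Assume that for each x ∈ I and all t, s ∈ [0,x]: Γ_x(t,s) + ∫₀ˣ H(t−u) Γ_x(u,s) du = H(t−s), and that for each x ∈ I the only continuous ψ on [0,x] with ψ(t) + ∫₀ˣ H(t−u) ψ(u) du = 0 is ψ ≡ 0. Then for every x ∈ I and all t, s ∈ [0,x]: ∂Γ_x(t,s)/∂x = −Γ_x(t,x) Γ_x(x,s). -/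
open MeasureTheory Set

lemma krein_aux_moving (g : ℝ → ℝ → ℝ) (hg : Continuous fun p : ℝ × ℝ => g p.1 p.2) (x : ℝ) :
    HasDerivAt (fun y : ℝ => ∫ u in x..y, g y u) (g x x) x := by
  have hK : Continuous fun y : ℝ => ∫ θ in (0:ℝ)..1, g y (x + (y - x) * θ) := by
    apply intervalIntegral.continuous_parametric_intervalIntegral_of_continuous'
    exact hg.comp (by fun_prop :
      Continuous fun p : ℝ × ℝ => ((p.1, x + (p.1 - x) * p.2) : ℝ × ℝ))
  have heq : (fun y : ℝ => ∫ u in x..y, g y u)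
      = fun y => (y - x) * ∫ θ in (0:ℝ)..1, g y (x + (y - x) * θ) := by
    funext y
    have h := intervalIntegral.smul_integral_comp_add_mul (a := 0) (b := 1) (fun u => g y u)
      (y - x) x
    simp only [smul_eq_mul] at h
    rw [h]; simp
  rw [heq, hasDerivAt_iff_tendsto_slope]
  have h0 := hK.tendsto x
  simp only [sub_self, zero_mul, add_zero, intervalIntegral.integral_const, sub_zero,
    one_smul] at h0
  refine (h0.mono_left nhdsWithin_le_nhds).congr' ?_
  filter_upwards [self_mem_nhdsWithin] with y hy
  have : y - x ≠ 0 := sub_ne_zero.2 hy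
  simp only [slope, vsub_eq_sub, sub_self, zero_mul, sub_zero, smul_eq_mul]
  field_simp

lemma krein_aux_fixed (a b : ℝ) (g dg : ℝ → ℝ → ℝ) (hg : Continuous fun p : ℝ × ℝ => g p.1 p.2)
    (hdg : Continuous fun p : ℝ × ℝ => dg p.1 p.2)
    (hd : ∀ u : ℝ, ∀ x ∈ Ioo a b, HasDerivAt (fun y => g y u) (dg x u) x)
    (x : ℝ) (hx : x ∈ Ioo a b) :
    HasDerivAt (fun y : ℝ => ∫ u in (0:ℝ)..x, g y u) (∫ u in (0:ℝ)..x, dg x u) x := by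
  have hcpt : IsCompact (Icc a b ×ˢ uIcc (0:ℝ) x) := isCompact_Icc.prod isCompact_uIcc
  obtain ⟨C, hC⟩ := hcpt.exists_bound_of_continuousOn hdg.continuousOn
  have hgy : ∀ y, Continuous (g y) := fun y => hg.comp (by fun_prop : Continuous fun u => (y, u))
  have hdgy : ∀ y, Continuous (dg y) := fun y =>
    hdg.comp (by fun_prop : Continuous fun u => (y, u))
  refine (intervalIntegral.hasDerivAt_integral_of_dominated_loc_of_deriv_le
    (F := g) (F' := dg) (s := Ioo a b) (bound := fun _ => C) (Ioo_mem_nhds hx.1 hx.2)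
    (Filter.Eventually.of_forall fun y => (hgy y).aestronglyMeasurable)
    ((hgy x).intervalIntegrable _ _) (hdgy x).aestronglyMeasurable ?_ (by simp) ?_).2
  · refine Filter.Eventually.of_forall fun u hu y hy => ?_
    exact hC (y, u) ⟨Ioo_subset_Icc_self hy, uIoc_subset_uIcc hu⟩
  · exact Filter.Eventually.of_forall fun u _ y hy => hd u y hy

/-- **Derivative identity for the Krein kernel (formula (2.20)):**
`∂Γₓ(t,s)/∂x = -Γₓ(t,x) Γₓ(x,s)`.
Let `H : ℝ → ℝ` be continuous and even, let `Ioo a b ⊆ (0,∞)` be an open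
interval, and let `(x,t,s) ↦ Γₓ(t,s)` be continuous and continuously
differentiable in `x` (with partial derivative `dΓ`). Assume that for each
`x ∈ Ioo a b` the kernel solves Krein's equation
`Γₓ(t,s) + ∫₀ˣ H(t-u) Γₓ(u,s) du = H(t-s)` for `t,s ∈ [0,x]`, and that the
homogeneous equation has only the trivial continuous solution on `[0,x]`.
Then `dΓₓ(t,s)/dx = -Γₓ(t,x) Γₓ(x,s)` for `x ∈ Ioo a b`, `t,s ∈ [0,x]`. -/
theorem krein_kernel_derivative_identity
    (H : ℝ → ℝ) (hHc : Continuous H) (heven : ∀ t : ℝ, H (-t) = H t)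
    (a b : ℝ) (ha : 0 ≤ a)
    (Γ dΓ : ℝ → ℝ → ℝ → ℝ)
    (hΓc : Continuous fun p : ℝ × ℝ × ℝ => Γ p.1 p.2.1 p.2.2)
    (hdΓc : Continuous fun p : ℝ × ℝ × ℝ => dΓ p.1 p.2.1 p.2.2)
    (hderiv : ∀ t s : ℝ, ∀ x ∈ Ioo a b,
      HasDerivAt (fun y : ℝ => Γ y t s) (dΓ x t s) x)
    (hΓeq : ∀ x ∈ Ioo a b, ∀ t ∈ Icc (0:ℝ) x, ∀ s ∈ Icc (0:ℝ) x,
      Γ x t s + ∫ u in (0:ℝ)..x, H (t - u) * Γ x u s = H (t - s))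
    (huniq : ∀ x ∈ Ioo a b, ∀ ψ : ℝ → ℝ, ContinuousOn ψ (Icc 0 x) →
      (∀ t ∈ Icc (0:ℝ) x, ψ t + ∫ u in (0:ℝ)..x, H (t - u) * ψ u = 0) →
      ∀ t ∈ Icc (0:ℝ) x, ψ t = 0) :
    ∀ x ∈ Ioo a b, ∀ t ∈ Icc (0:ℝ) x, ∀ s ∈ Icc (0:ℝ) x,
      dΓ x t s = -(Γ x t x * Γ x x s) := by
  intro x hx t ht s hs
  have hx0 : 0 ≤ x := ha.trans hx.1.le
  have hxx : x ∈ Icc (0:ℝ) x := ⟨hx0, le_rfl⟩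
  have hcd : Continuous fun u => dΓ x u s :=
    hdΓc.comp (by fun_prop : Continuous fun u : ℝ => ((x, u, s) : ℝ × ℝ × ℝ))
  have hcx : Continuous fun u => Γ x u x :=
    hΓc.comp (by fun_prop : Continuous fun u : ℝ => ((x, u, x) : ℝ × ℝ × ℝ))
  have key : ∀ t ∈ Icc (0:ℝ) x,
      dΓ x t s + ((∫ u in (0:ℝ)..x, H (t - u) * dΓ x u s) + H (t - x) * Γ x x s) = 0 := by
    intro t ht
    have hg : Continuous fun p : ℝ × ℝ => H (t - p.2) * Γ p.1 p.2 s :=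
      (hHc.comp (by fun_prop : Continuous fun p : ℝ × ℝ => t - p.2)).mul
        (hΓc.comp (by fun_prop : Continuous fun p : ℝ × ℝ => ((p.1, p.2, s) : ℝ × ℝ × ℝ)))
    have hdg : Continuous fun p : ℝ × ℝ => H (t - p.2) * dΓ p.1 p.2 s :=
      (hHc.comp (by fun_prop : Continuous fun p : ℝ × ℝ => t - p.2)).mul
        (hdΓc.comp (by fun_prop : Continuous fun p : ℝ × ℝ => ((p.1, p.2, s) : ℝ × ℝ × ℝ)))
    have h1 := krein_aux_moving (fun y u => H (t - u) * Γ y u s) hg x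
    have h2 := krein_aux_fixed a b (fun y u => H (t - u) * Γ y u s)
      (fun y u => H (t - u) * dΓ y u s) hg hdg
      (fun u y hy => (hderiv u s y hy).const_mul _) x hx
    have h3 := ((hderiv t s x hx).add (h2.add h1)).hasDerivWithinAt (s := Ici x)
    have h4 : HasDerivWithinAt (fun _ : ℝ => H (t - s)) 0 (Ici x) x :=
      hasDerivWithinAt_const _ _ _
    have h5 : ∀ y ∈ Ici x, y ∈ Ioo a b →
        Γ y t s + ((∫ u in (0:ℝ)..x, H (t - u) * Γ y u s)
          + ∫ u in x..y, H (t - u) * Γ y u s) = H (t - s) := by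
      intro y hy hyab
      have hc : Continuous fun u => H (t - u) * Γ y u s :=
        hg.comp (by fun_prop : Continuous fun u : ℝ => ((y, u) : ℝ × ℝ))
      rw [intervalIntegral.integral_add_adjacent_intervals (hc.intervalIntegrable _ _)
        (hc.intervalIntegrable _ _)]
      exact hΓeq y hyab t ⟨ht.1, ht.2.trans hy⟩ s ⟨hs.1, hs.2.trans hy⟩
    have h6 := h4.congr_of_eventuallyEq (f₁ := fun y => Γ y t s +
        ((∫ u in (0:ℝ)..x, H (t - u) * Γ y u s) + ∫ u in x..y, H (t - u) * Γ y u s))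
      (by
        filter_upwards [self_mem_nhdsWithin,
          mem_nhdsWithin_of_mem_nhds (Ioo_mem_nhds hx.1 hx.2)] with y hy hyab
        exact h5 y hy hyab) (h5 x self_mem_Ici hx)
    exact (uniqueDiffWithinAt_Ici x).eq_deriv _ h3 h6
  have := huniq x hx (fun t => dΓ x t s + Γ x t x * Γ x x s)
    (hcd.add (hcx.mul continuous_const)).continuousOn ?_ t ht
  · have := this
    linarith
  · intro t ht
    have hHt : Continuous fun u => H (t - u) := hHc.comp (by fun_prop)
    have e : (∫ u in (0:ℝ)..x, H (t - u) * (dΓ x u s + Γ x u x * Γ x x s))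
        = (∫ u in (0:ℝ)..x, H (t - u) * dΓ x u s)
          + (∫ u in (0:ℝ)..x, H (t - u) * Γ x u x) * Γ x x s := by
      rw [← intervalIntegral.integral_mul_const, ← intervalIntegral.integral_add]
      · congr 1; funext u; ring
      · exact (hHt.mul hcd).intervalIntegrable _ _
      · exact ((hHt.mul hcx).mul continuous_const).intervalIntegrable _ _
    simp only [e]
    have k1 := key t ht
    have k2 := hΓeq x hx t ht x hxx
    rw [← k2] at k1
    linarith
end

section
/- Let H : ℝ → ℝ be continuous and even, and let (x,t,s) ↦ Γ_x(t,s) be a continuous family, continuously differentiable in x, such that for each x > 0 and all t, s ∈ [0,x]: Γ_x(t,s) + ∫₀ˣ H(t−u) Γ_x(u,s) du = H(t−s), and such that the identities ∂Γ_x(t,s)/∂x = −Γ_x(t,x) Γ_x(x,s) and Γ_x(t,s) = Γ_x(x−t, x−s) hold. Define A(x) := 2 Γ_{2x}(2x, 0) and, for k ∈ ℝ, E(x,k) := e^{ikx} ( 1 − ∫₀^{2x} Γ_{2x}(s,0) e^{−iks} ds ). Then for every x > 0: ∂E(x,k)/∂x = ik E(x,k) − A(x) E(x,−k), and E(0,k)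 = 1. -/
open MeasureTheory Set

/-- `A(x) := 2 Γ_{2x}(2x, 0)` from Krein's method (formula (1.18)). -/
noncomputable def kreinA (Γ : ℝ → ℝ → ℝ → ℝ) (x : ℝ) : ℝ :=
  2 * Γ (2 * x) (2 * x) 0

/-- `E(x,k) := e^{ikx} (1 - ∫₀^{2x} Γ_{2x}(s,0) e^{-iks} ds)` from Krein's
method (formula (1.11)). -/
noncomputable def kreinE (Γ : ℝ → ℝ → ℝ → ℝ) (k x : ℝ) : ℂ :=
  Complex.exp (Complex.I * k * x) *
    (1 - ∫ s in (0:ℝ)..(2 * x), (Γ (2 * x) s 0 : ℂ) *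
      Complex.exp (-Complex.I * k * s))


theorem krein_leibniz (g dg : ℝ → ℝ → ℂ)
    (hg : Continuous fun p : ℝ × ℝ => g p.1 p.2)
    (hdg : Continuous fun p : ℝ × ℝ => dg p.1 p.2)
    (hd : ∀ s x : ℝ, 0 < x → HasDerivAt (fun y : ℝ => g y s) (dg x s) x)
    (X : ℝ) (hX : 0 < X) :
    HasDerivAt (fun y : ℝ => ∫ s in (0:ℝ)..y, g y s)
      ((∫ s in (0:ℝ)..X, dg X s) + g X X) X := by
  have hgy : ∀ y, Continuous (g y) := fun y =>
    hg.comp (continuous_const.prodMk continuous_id)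
  have hdgy : ∀ y, Continuous (dg y) := fun y =>
    hdg.comp (continuous_const.prodMk continuous_id)
  have h1 : HasDerivAt (fun y : ℝ => ∫ s in (0:ℝ)..X, g y s)
      (∫ s in (0:ℝ)..X, dg X s) X := by
    obtain ⟨C, hC⟩ := ((isCompact_Icc (a := X/2) (b := 2*X)).prod
      (isCompact_Icc (a := (0:ℝ)) (b := X))).exists_bound_of_continuousOn hdg.continuousOn
    refine (intervalIntegral.hasDerivAt_integral_of_dominated_loc_of_deriv_le
      (s := Icc (X/2) (2*X)) (bound := fun _ => C) (F' := dg)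
      (Icc_mem_nhds (by linarith) (by linarith)) ?_ ?_ ?_ ?_ ?_ ?_).2
    · exact Filter.Eventually.of_forall fun y => (hgy y).aestronglyMeasurable
    · exact (hgy X).intervalIntegrable _ _
    · exact (hdgy X).aestronglyMeasurable
    · refine Filter.Eventually.of_forall fun t ht x hx => ?_
      rw [uIoc_of_le hX.le] at ht
      exact hC (x, t) ⟨hx, ht.1.le, ht.2⟩
    · exact intervalIntegrable_const
    · refine Filter.Eventually.of_forall fun t _ x hx => hd t x ?_
      linarith [hx.1]
  have h2 : HasDerivAt (fun y : ℝ => ∫ s in X..y, g y s) (g X X) X := by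
    rw [hasDerivAt_iff_isLittleO, Asymptotics.isLittleO_iff]
    intro c hc
    obtain ⟨δ, hδ, hb⟩ := Metric.continuousAt_iff.1 (hg.continuousAt (x := (X, X))) c hc
    filter_upwards [Metric.ball_mem_nhds X hδ] with y hy
    have e : (∫ s in X..y, g y s) - (∫ s in X..X, g X s) - (y - X) • g X X
        = ∫ s in X..y, (g y s - g X X) := by
      rw [intervalIntegral.integral_sub ((hgy y).intervalIntegrable _ _)
        intervalIntegrable_const]
      simp
    rw [e, Real.norm_eq_abs]
    refine intervalIntegral.norm_integral_le_of_norm_le_const fun s hs => ?_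
    have hs' : dist s X ≤ dist y X := by
      rw [Real.dist_eq, Real.dist_eq]
      exact abs_sub_left_of_mem_uIcc (uIoc_subset_uIcc hs)
    have := @hb (y, s) (by
      rw [Prod.dist_eq]
      exact max_lt hy (lt_of_le_of_lt hs' hy))
    rw [dist_eq_norm] at this
    exact this.le
  have h3 := h1.add h2
  refine h3.congr_of_eventuallyEq (Filter.Eventually.of_forall fun y => ?_)
  exact (intervalIntegral.integral_add_adjacent_intervals
    ((hgy y).intervalIntegrable _ _) ((hgy y).intervalIntegrable _ _)).symm

/-- **The Krein function `E(x,k)` solves the first-order system (2.17).**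
Let `H : ℝ → ℝ` be continuous and even and let `(x,t,s) ↦ Γₓ(t,s)` be a
continuous family, continuously differentiable in `x` (with partial
derivative `dΓ`), solving Krein's equation
`Γₓ(t,s) + ∫₀ˣ H(t-u) Γₓ(u,s) du = H(t-s)` for each `x > 0`, `t,s ∈ [0,x]`,
and satisfying `∂Γₓ(t,s)/∂x = -Γₓ(t,x)Γₓ(x,s)` and `Γₓ(t,s) = Γₓ(x-t,x-s)`.
Then with `A(x) = 2Γ_{2x}(2x,0)` and
`E(x,k) = e^{ikx}(1 - ∫₀^{2x} Γ_{2x}(s,0) e^{-iks} ds)` one has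
`∂E(x,k)/∂x = ik E(x,k) - A(x) E(x,-k)` for every `x > 0`, and `E(0,k) = 1`. -/
theorem kreinE_satisfies_system
    (H : ℝ → ℝ) (hHc : Continuous H) (heven : ∀ t : ℝ, H (-t) = H t)
    (Γ dΓ : ℝ → ℝ → ℝ → ℝ)
    (hΓc : Continuous fun p : ℝ × ℝ × ℝ => Γ p.1 p.2.1 p.2.2)
    (hdΓc : Continuous fun p : ℝ × ℝ × ℝ => dΓ p.1 p.2.1 p.2.2)
    (hderiv : ∀ t s x : ℝ, 0 < x →
      HasDerivAt (fun y : ℝ => Γ y t s) (dΓ x t s) x)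
    (hΓeq : ∀ x : ℝ, 0 < x → ∀ t ∈ Icc (0:ℝ) x, ∀ s ∈ Icc (0:ℝ) x,
      Γ x t s + ∫ u in (0:ℝ)..x, H (t - u) * Γ x u s = H (t - s))
    (hdΓeq : ∀ x : ℝ, 0 < x → ∀ t ∈ Icc (0:ℝ) x, ∀ s ∈ Icc (0:ℝ) x,
      dΓ x t s = -(Γ x t x * Γ x x s))
    (hsym : ∀ x : ℝ, 0 < x → ∀ t ∈ Icc (0:ℝ) x, ∀ s ∈ Icc (0:ℝ) x,
      Γ x t s = Γ x (x - t) (x - s))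
    (k : ℝ) :
    (∀ x : ℝ, 0 < x →
      HasDerivAt (fun y : ℝ => kreinE Γ k y)
        (Complex.I * k * kreinE Γ k x - (kreinA Γ x : ℂ) * kreinE Γ (-k) x)
        x) ∧
    kreinE Γ k 0 = 1 := by
  refine ⟨fun x hx => ?_, by simp [kreinE]⟩
  have hX : 0 < 2 * x := by linarith
  have hL := krein_leibniz
    (fun y s => (Γ y s 0 : ℂ) * Complex.exp (-Complex.I * k * s))
    (fun y s => (dΓ y s 0 : ℂ) * Complex.exp (-Complex.I * k * s))
    (by
      have : Continuous fun p : ℝ × ℝ => Γ p.1 p.2 0 :=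
        hΓc.comp (continuous_fst.prodMk (continuous_snd.prodMk continuous_const))
      fun_prop)
    (by
      have : Continuous fun p : ℝ × ℝ => dΓ p.1 p.2 0 :=
        hdΓc.comp (continuous_fst.prodMk (continuous_snd.prodMk continuous_const))
      fun_prop)
    (fun s y hy => (hderiv s 0 y hy).ofReal_comp.mul_const _) (2 * x) hX
  have hI : (∫ s in (0:ℝ)..(2 * x), (dΓ (2 * x) s 0 : ℂ) * Complex.exp (-Complex.I * k * s))
      = -(Γ (2 * x) (2 * x) 0 : ℂ) * Complex.exp (-Complex.I * k * (2 * x)) *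
        ∫ s in (0:ℝ)..(2 * x), (Γ (2 * x) s 0 : ℂ) * Complex.exp (Complex.I * k * s) := by
    have hr := intervalIntegral.integral_comp_sub_left (a := 0) (b := 2 * x)
      (fun s : ℝ => (Γ (2 * x) s 0 : ℂ) * Complex.exp (Complex.I * k * s)) (2 * x)
    rw [sub_self, sub_zero] at hr
    rw [← hr, ← intervalIntegral.integral_const_mul]
    refine intervalIntegral.integral_congr fun s hs => ?_
    rw [uIcc_of_le hX.le] at hs
    have h0 : (0:ℝ) ∈ Icc (0:ℝ) (2 * x) := ⟨le_rfl, hX.le⟩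
    have h1 : (2 * x) ∈ Icc (0:ℝ) (2 * x) := ⟨hX.le, le_rfl⟩
    have e1 := hdΓeq (2 * x) hX s hs 0 h0
    have e2 := hsym (2 * x) hX s hs (2 * x) h1
    rw [sub_self] at e2
    have e3 : Complex.exp (-Complex.I * k * s) = Complex.exp (-Complex.I * k * (2 * x)) *
        Complex.exp (Complex.I * k * ((2 * x - s : ℝ) : ℂ)) := by
      rw [← Complex.exp_add]
      congr 1
      push_cast
      ring
    rw [e1, e2, e3]
    push_cast
    ring
  rw [hI] at hL
  have hlin : HasDerivAt (fun y : ℝ => 2 * y) 2 x := by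
    simpa using (hasDerivAt_id x).const_mul (2:ℝ)
  have hL2 := HasDerivAt.scomp x hL hlin
  have hE : HasDerivAt (fun y : ℝ => Complex.exp (Complex.I * k * y))
      (Complex.exp (Complex.I * k * x) * (Complex.I * k)) x := by
    have := ((hasDerivAt_id x).ofReal_comp.const_mul (Complex.I * k)).cexp
    simpa using this
  have hF := hE.mul (hL2.const_sub 1)
  refine hF.congr_deriv ?_
  have e4 : Complex.exp (-Complex.I * k * (2 * x)) =
      Complex.exp (-(Complex.I * k * x)) * Complex.exp (-(Complex.I * k * x)) := by
    rw [← Complex.exp_add]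
    congr 1
    ring
  have e5 : Complex.exp (Complex.I * k * x) * Complex.exp (-(Complex.I * k * x)) = 1 := by
    rw [← Complex.exp_add, add_neg_cancel, Complex.exp_zero]
  simp only [kreinE, kreinA, Function.comp, Complex.real_smul]
  push_cast
  simp only [mul_neg, neg_mul, neg_neg] at e4 ⊢
  rw [e4]
  generalize Complex.exp (Complex.I * k * x) = a at *
  generalize Complex.exp (-(Complex.I * k * x)) = b at *
  generalize (∫ s in (0:ℝ)..(2 * x), (Γ (2 * x) s 0 : ℂ) * Complex.exp (Complex.I * k * s)) = J
  linear_combination (-2 * (Γ (2 * x) (2 * x) 0 : ℂ) * b * (1 - J)) * e5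
end

section
/- Let k ∈ ℂ, let A : ℝ → ℝ be differentiable, and let E, F : ℝ → ℂ be differentiable functions satisfying E′(x) = ik E(x) − A(x) F(x) and F′(x) = −ik F(x) − A(x) E(x) for all x. Then ψ := (E − F)/(2i) is twice differentiable and satisfies the Schrödinger equation ψ″(x) + k² ψ(x) − q(x) ψ(x) = 0 for all x, where q(x) := A(x)² + A′(x). -/
/-- **From the first-order system to the Schrödinger equation (Lemma 2.3).**
Let `k ∈ ℂ`, let `A : ℝ → ℝ` be differentiable, and let `E, F : ℝ → ℂ` be
differentiable with `E' = ikE - AF` and `F' = -ikF - AE`. Then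
`ψ := (E - F)/(2i)` is twice differentiable and satisfies
`ψ'' + k²ψ - qψ = 0`, where `q := A² + A'`. -/
theorem schroedinger_from_krein_system
    (k : ℂ) (A : ℝ → ℝ) (hA : Differentiable ℝ A)
    (E F : ℝ → ℂ)
    (hE : ∀ x : ℝ, HasDerivAt E (Complex.I * k * E x - (A x : ℂ) * F x) x)
    (hF : ∀ x : ℝ, HasDerivAt F (-Complex.I * k * F x - (A x : ℂ) * E x) x) :
    ∀ x : ℝ,
      DifferentiableAt ℝ (deriv fun y : ℝ => (E y - F y) / (2 * Complex.I)) x ∧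
      deriv (deriv fun y : ℝ => (E y - F y) / (2 * Complex.I)) x
          + k ^ 2 * ((E x - F x) / (2 * Complex.I))
          - (((A x) ^ 2 + deriv A x : ℝ) : ℂ) * ((E x - F x) / (2 * Complex.I))
        = 0 := by
  have h1 : (deriv fun y : ℝ => (E y - F y) / (2 * Complex.I)) = fun y : ℝ =>
      (Complex.I * k * (E y + F y) + (A y : ℂ) * (E y - F y)) / (2 * Complex.I) := by
    funext y
    refine (((hE y).sub (hF y)).div_const (2 * Complex.I)).deriv.trans ?_
    ring
  intro x
  have hAx : HasDerivAt (fun y : ℝ => (A y : ℂ)) ((deriv A x : ℝ) : ℂ) x :=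
    (hA x).hasDerivAt.ofReal_comp
  have h2 := ((((hE x).add (hF x)).const_mul (Complex.I * k)).add
    (hAx.mul ((hE x).sub (hF x)))).div_const (2 * Complex.I)
  have h3 : HasDerivAt (fun y : ℝ =>
      (Complex.I * k * (E y + F y) + (A y : ℂ) * (E y - F y)) / (2 * Complex.I)) _ x := h2
  rw [h1]
  refine ⟨h3.differentiableAt, ?_⟩
  rw [h3.deriv]
  simp only [Pi.sub_apply]
  push_cast
  linear_combination (k ^ 2 * (E x - F x) / (2 * Complex.I)) * Complex.I_sq
end
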